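/- Assume Ψ satisfies the SOSC with feasible open set O, let μ_p be a self-similar measure, and assume μ_p(∂O) = 0 and that μ_p gives zero measure to every sphere in ℝⁿ (both known properties of self-similar measures under the SOSC). Let Ê be the set of points of E with dense shift orbit; then μ_p(E ∖ Ê) = 0, and for every x ∈ Ê and every typical ball B(z, ρ) (z ∈ E, ρ > 0, B(z, ρ) ⊆ O) there exist surjective similarities g_j of ℝⁿ with ratios t_j → ∞ and constants c_j > 0 such that the measures c_j · (g_j)_♯ (μ_p⌊_{B(x, ρ·t_j⁻¹)}) converge setwise to μ_p⌊_{B(z, ρ)}. In particular (up to isometry and positive multiple), every restriction of μ_p to a typical ball is a strong tangent measure of μ_p at every point of Ê. -/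

import Mathlib

open MeasureTheory Filter Topology
open scoped ENNReal

noncomputable section

/-- `f` is a similarity of ratio `r`. -/
def IsSimilarityRatio {X : Type*} [MetricSpace X] (f : X → X) (r : ℝ) : Prop :=
  ∀ x y, dist (f x) (f y) = r * dist x y

/-- The composition `f_{i₁} ∘ ⋯ ∘ f_{i_k}` associated with a finite word. -/
def wordMap {X : Type*} {m : ℕ} (f : Fin m → X → X) : List (Fin m) → X → X
  | [] => id
  | j :: l => f j ∘ wordMap f l

/-- The set `Ê` of points of `E` with dense shift orbit. -/
def denseOrbitSet {X : Type*} {m : ℕ} [TopologicalSpace X]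
    (f : Fin m → X → X) (E : Set X) : Set X :=
  {y | y ∈ E ∧ E ⊆ closure {w | w ∈ E ∧ ∃ l : List (Fin m), l ≠ [] ∧ wordMap f l w = y}}

namespace IsSimilarityRatio

variable {X : Type*} [MetricSpace X] {f g : X → X} {r s : ℝ}

theorem comp (hf : IsSimilarityRatio f r) (hg : IsSimilarityRatio g s) :
    IsSimilarityRatio (f ∘ g) (r * s) := fun x y => by
  rw [Function.comp_apply, Function.comp_apply, hf, hg, mul_assoc]

theorem injective (hf : IsSimilarityRatio f r) (hr : 0 < r) : Function.Injective f :=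
    fun x y h => by
  have := hf x y
  rw [h, dist_self] at this
  exact dist_eq_zero.1 ((mul_eq_zero.1 this.symm).resolve_left hr.ne')

theorem continuous (hf : IsSimilarityRatio f r) (hr : 0 < r) : Continuous f :=
  (LipschitzWith.of_dist_le_mul (K := r.toNNReal) fun x y => by
    rw [hf, Real.coe_toNNReal r hr.le]).continuous

theorem of_rightInverse (hf : IsSimilarityRatio f r) (hr : 0 < r)
    (h : Function.RightInverse g f) : IsSimilarityRatio g r⁻¹ := fun x y => by
  have := hf (g x) (g y)
  rw [h x, h y] at this
  rw [this, inv_mul_cancel_left₀ hr.ne']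

theorem image_closedBall (hf : IsSimilarityRatio f r) (hr : 0 < r) (hs : Function.Surjective f)
    (x : X) (ρ : ℝ) : f '' Metric.closedBall x ρ = Metric.closedBall (f x) (ρ * r) := by
  ext y
  obtain ⟨y, rfl⟩ := hs y
  rw [(hf.injective hr).mem_set_image, Metric.mem_closedBall, Metric.mem_closedBall, hf,
    mul_comm ρ, mul_le_mul_iff_right₀ hr]

theorem surjective {V : Type*} [NormedAddCommGroup V] [InnerProductSpace ℝ V]
    [FiniteDimensional ℝ V] {f : V → V} (hf : IsSimilarityRatio f r) (hr : 0 < r) :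
    Function.Surjective f := by
  have hiso : Isometry fun x => r⁻¹ • f x := Isometry.of_dist_eq fun x y => by
    rw [dist_smul₀, hf, Real.norm_of_nonneg (inv_nonneg.2 hr.le), inv_mul_cancel_left₀ hr.ne']
  intro y
  have : Inhabited V := ⟨0⟩
  obtain ⟨x, hx⟩ :=
    (hiso.affineIsometryOfStrictConvexSpace.toAffineIsometryEquiv rfl).surjective (r⁻¹ • y)
  rw [AffineIsometry.coe_toAffineIsometryEquiv, Isometry.coe_affineIsometryOfStrictConvexSpace]
    at hx
  exact ⟨x, smul_right_injective V (inv_ne_zero hr.ne') hx⟩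

theorem isHomeomorph (hf : IsSimilarityRatio f r) (hr : 0 < r) (hs : Function.Surjective f) :
    IsHomeomorph f := by
  refine ⟨hf.continuous hr, fun U hU => ?_, hf.injective hr, hs⟩
  have hg := hf.of_rightInverse hr (Function.rightInverse_surjInv hs)
  rw [Set.image_eq_preimage_of_inverse
    (Function.leftInverse_surjInv ⟨hf.injective hr, hs⟩) (Function.rightInverse_surjInv hs)]
  exact hU.preimage (hg.continuous (inv_pos.2 hr))

end IsSimilarityRatio

theorem prod_map_pos {ι : Type*} {r : ι → ℝ} (hr : ∀ i, 0 < r i) (l : List ι) :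
    0 < (l.map r).prod := by
  induction l with
  | nil => simp
  | cons i l ih => simpa using mul_pos (hr i) ih

theorem exists_forall_length_prod_map_lt {ι : Type*} [Finite ι] [Nonempty ι] {r : ι → ℝ}
    (hr : ∀ i, r i ∈ Set.Ioo (0 : ℝ) 1) {ε : ℝ} (hε : 0 < ε) :
    ∃ K : ℕ, ∀ l : List ι, K ≤ l.length → (l.map r).prod < ε := by
  obtain ⟨i₀, hi₀⟩ := Finite.exists_max r
  obtain ⟨K, hK⟩ := exists_pow_lt_of_lt_one hε (hr i₀).2
  have key : ∀ l : List ι, (l.map r).prod ≤ r i₀ ^ l.length := by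
    intro l
    induction l with
    | nil => simp
    | cons i l ih =>
      rw [List.map_cons, List.prod_cons, List.length_cons, pow_succ']
      exact mul_le_mul (hi₀ i) ih (prod_map_pos (fun i => (hr i).1) l).le (hr i₀).1.le
  exact ⟨K, fun l hl => ((key l).trans
    (pow_le_pow_of_le_one (hr i₀).1.le (hr i₀).2.le hl)).trans_lt hK⟩

section wordMap

variable {X : Type*} {m : ℕ} {f : Fin m → X → X}

theorem wordMap_surjective (hf : ∀ i, Function.Surjective (f i)) (l : List (Fin m)) :
    Function.Surjective (wordMap f l) := by
  induction l with
  | nil => exact Function.surjective_id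
  | cons i l ih => exact (hf i).comp ih

theorem mapsTo_wordMap {s : Set X} (hf : ∀ i, Set.MapsTo (f i) s s) (l : List (Fin m)) :
    Set.MapsTo (wordMap f l) s s := by
  induction l with
  | nil => exact Set.mapsTo_id s
  | cons i l ih => exact (hf i).comp ih

theorem isSimilarityRatio_wordMap [MetricSpace X] {r : Fin m → ℝ}
    (hf : ∀ i, IsSimilarityRatio (f i) (r i)) (l : List (Fin m)) :
    IsSimilarityRatio (wordMap f l) (l.map r).prod := by
  induction l with
  | nil => intro x y; simp [wordMap]
  | cons i l ih => rw [List.map_cons, List.prod_cons]; exact (hf i).comp ih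

theorem exists_wordMap_eq_of_length {E : Set X} (hE : E = ⋃ i, f i '' E) (k : ℕ) :
    ∀ e ∈ E, ∃ l : List (Fin m), l.length = k ∧ ∃ e' ∈ E, wordMap f l e' = e := by
  induction k with
  | zero => exact fun e he => ⟨[], rfl, e, he, rfl⟩
  | succ k ih =>
    intro e he
    rw [hE] at he
    obtain ⟨i, e₁, he₁, rfl⟩ := Set.mem_iUnion.1 he
    obtain ⟨l, hl, e', he', rfl⟩ := ih e₁ he₁
    exact ⟨i :: l, by rw [List.length_cons, hl], e', he', rfl⟩

/-- Every point of the attractor is approximated by images of any given point under long words. -/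
theorem exists_wordMap_dist_lt [MetricSpace X] [Nonempty (Fin m)] {r : Fin m → ℝ}
    (hr : ∀ i, r i ∈ Set.Ioo (0 : ℝ) 1) (hf : ∀ i, IsSimilarityRatio (f i) (r i))
    {E B : Set X} (hE : E = ⋃ i, f i '' E) (hEb : Bornology.IsBounded E)
    (hB : Bornology.IsBounded B) {e : X} (he : e ∈ E) {ε : ℝ} (hε : 0 < ε) :
    ∃ l : List (Fin m), ∀ y ∈ B, dist (wordMap f l y) e < ε := by
  obtain ⟨C, hC⟩ := (Metric.isBounded_iff.1 (hEb.union hB))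
  have hC' : 0 < |C| + 1 := by positivity
  obtain ⟨K, hK⟩ := exists_forall_length_prod_map_lt hr (div_pos hε hC')
  obtain ⟨l, hl, e', he', rfl⟩ := exists_wordMap_eq_of_length hE K e he
  refine ⟨l, fun y hy => ?_⟩
  rw [isSimilarityRatio_wordMap hf]
  have h1 : dist y e' ≤ |C| + 1 :=
    (hC (Or.inr hy) (Or.inl he')).trans ((le_abs_self C).trans (by linarith))
  calc _ ≤ (l.map r).prod * (|C| + 1) :=
        mul_le_mul_of_nonneg_left h1 (prod_map_pos (fun i => (hr i).1) l).le
    _ < ε := (lt_div_iff₀ hC').1 (hK l hl.ge)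

/-- The attractor lies in the closure of every nonempty forward invariant set. -/
theorem subset_closure_of_mapsTo [MetricSpace X] [Nonempty (Fin m)] {r : Fin m → ℝ}
    (hr : ∀ i, r i ∈ Set.Ioo (0 : ℝ) 1) (hf : ∀ i, IsSimilarityRatio (f i) (r i))
    {E O : Set X} (hE : E = ⋃ i, f i '' E) (hEb : Bornology.IsBounded E)
    (hO : O.Nonempty) (hOmap : ∀ i, Set.MapsTo (f i) O O) : E ⊆ closure O := by
  obtain ⟨y, hy⟩ := hO
  refine fun e he => Metric.mem_closure_iff.2 fun ε hε => ?_
  obtain ⟨l, hl⟩ := exists_wordMap_dist_lt hr hf hE hEb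
    (Bornology.isBounded_singleton (x := y)) he hε
  exact ⟨_, mapsTo_wordMap hOmap l hy, by rw [dist_comm]; exact hl y rfl⟩

theorem quasiMeasurePreserving_wordMap [MeasurableSpace X] {ν : Measure X}
    (hf : ∀ i, Measure.QuasiMeasurePreserving (f i) ν ν) (l : List (Fin m)) :
    Measure.QuasiMeasurePreserving (wordMap f l) ν ν := by
  induction l with
  | nil => exact Measure.QuasiMeasurePreserving.id ν
  | cons i l ih => exact (hf i).comp ih

end wordMap

section SelfSimilar

variable {X : Type*} [MeasurableSpace X] {m : ℕ} {f : Fin m → X → X} {p : Fin m → ℝ}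
  {μ : Measure X}

theorem selfSimilar_apply (hf : ∀ i, Measurable (f i))
    (hinv : μ = ∑ i, ENNReal.ofReal (p i) • μ.map (f i)) {A : Set X} (hA : MeasurableSet A) :
    μ A = ∑ i, ENNReal.ofReal (p i) * μ (f i ⁻¹' A) := by
  conv_lhs => rw [hinv]
  simp only [Measure.coe_finsetSum, Finset.sum_apply, Measure.smul_apply, smul_eq_mul]
  exact Finset.sum_congr rfl fun i _ => by rw [Measure.map_apply (hf i) hA]

/-- If all preimages of `N` are contained in `N`, then `f i` does not charge null sets of the
restriction of a self-similar measure to `N`. -/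
theorem quasiMeasurePreserving_restrict [IsFiniteMeasure μ] (hf : ∀ i, Measurable (f i))
    (hp : ∀ i, 0 < p i) (hpsum : ∑ i, p i = 1)
    (hinv : μ = ∑ i, ENNReal.ofReal (p i) • μ.map (f i)) {N : Set X} (hN : MeasurableSet N)
    (hsub : ∀ i, f i ⁻¹' N ⊆ N) (i : Fin m) :
    Measure.QuasiMeasurePreserving (f i) (μ.restrict N) (μ.restrict N) := by
  have hp' : ∀ i, ENNReal.ofReal (p i) ≠ 0 := fun i => (ENNReal.ofReal_pos.2 (hp i)).ne'
  have hsum : ∑ i, ENNReal.ofReal (p i) = 1 := by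
    rw [← ENNReal.ofReal_sum_of_nonneg fun i _ => (hp i).le, hpsum, ENNReal.ofReal_one]
  have hdiff : μ (N \ f i ⁻¹' N) = 0 := by
    have h1 : μ N = ∑ j, ENNReal.ofReal (p j) * (μ N - μ (N \ f j ⁻¹' N)) := by
      conv_lhs => rw [selfSimilar_apply hf hinv hN]
      refine Finset.sum_congr rfl fun j _ => ?_
      rw [measure_sdiff (hsub j) ((hf j) hN).nullMeasurableSet (measure_ne_top _ _),
        ENNReal.sub_sub_cancel (measure_ne_top _ _) (measure_mono (hsub j))]
    have h2 : ∑ j, ENNReal.ofReal (p j) * μ (N \ f j ⁻¹' N) = 0 := by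
      have h3 : μ N + ∑ j, ENNReal.ofReal (p j) * μ (N \ f j ⁻¹' N) = μ N := by
        conv_lhs => rw [h1]
        rw [← Finset.sum_add_distrib]
        simp_rw [← mul_add, tsub_add_cancel_of_le (measure_mono (μ := μ) Set.sdiff_subset)]
        rw [← Finset.sum_mul, hsum, one_mul]
      exact (ENNReal.add_right_inj (measure_ne_top μ N)).1 (h3.trans (add_zero _).symm)
    exact (mul_eq_zero.1 (Finset.sum_eq_zero_iff.1 h2 i (Finset.mem_univ i))).resolve_left (hp' i)
  refine ⟨hf i, Measure.AbsolutelyContinuous.mk fun B hB hνB => ?_⟩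
  rw [Measure.map_apply (hf i) hB, Measure.restrict_apply (hf i hB)]
  rw [Measure.restrict_apply hB, selfSimilar_apply hf hinv (hB.inter hN)] at hνB
  have h4 := (mul_eq_zero.1
    (Finset.sum_eq_zero_iff.1 hνB i (Finset.mem_univ i))).resolve_left (hp' i)
  refine measure_mono_null (fun y hy => ?_) (measure_union_null h4 hdiff)
  by_cases h : f i y ∈ N
  · exact Or.inl ⟨hy.1, h⟩
  · exact Or.inr ⟨hy.2, h⟩

theorem measure_eq_zero_of_measure_inter_image [IsFiniteMeasure μ] (hf : ∀ i, Measurable (f i))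
    (hp : ∀ i, 0 < p i) (hpsum : ∑ i, p i = 1)
    (hinv : μ = ∑ i, ENNReal.ofReal (p i) • μ.map (f i)) {E : Set X} (hE : μ Eᶜ = 0)
    {N : Set X} (hN : MeasurableSet N) (hsub : ∀ i, f i ⁻¹' N ⊆ N) (l : List (Fin m))
    (hl : μ (wordMap f l '' E ∩ N) = 0) : μ N = 0 := by
  have hq := quasiMeasurePreserving_wordMap
    (quasiMeasurePreserving_restrict hf hp hpsum hinv hN hsub) l
  rw [← Measure.restrict_apply' hN] at hl
  have h := measure_mono_null (Set.subset_preimage_image (wordMap f l) E) (hq.preimage_null hl)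
  rw [Measure.restrict_apply' hN] at h
  refine measure_mono_null (fun y hy => ?_) (measure_union_null h hE)
  by_cases hyE : y ∈ E
  · exact Or.inl ⟨hyE, hy⟩
  · exact Or.inr hyE

/-- Scaling of a self-similar measure inside a feasible open set. -/
theorem measure_wordMap_image [TopologicalSpace X] [BorelSpace X]
    (hf : ∀ i, IsHomeomorph (f i))
    (hinv : μ = ∑ i, ENNReal.ofReal (p i) • μ.map (f i)) {E O : Set X} (hE : μ Eᶜ = 0)
    (hO : IsOpen O) (hEO : E ⊆ closure O) (hOmap : ∀ i, Set.MapsTo (f i) O O)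
    (hOdisj : ∀ i j, i ≠ j → Disjoint (f i '' O) (f j '' O))
    (l : List (Fin m)) {B : Set X} (hB : MeasurableSet B) (hBO : B ⊆ O) :
    MeasurableSet (wordMap f l '' B) ∧
      μ (wordMap f l '' B) = (l.map fun i => ENNReal.ofReal (p i)).prod * μ B := by
  have hemb : ∀ i, MeasurableEmbedding (f i) := fun i => (hf i).homeomorph.measurableEmbedding
  induction l with
  | nil => simpa [wordMap] using hB
  | cons j l ih =>
    have hsub : wordMap f l '' B ⊆ O := ((mapsTo_wordMap hOmap l).mono_left hBO).image_subset
    set D := wordMap f l '' B with hD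
    have hDm : MeasurableSet (f j '' D) := (hemb j).measurableSet_image.2 ih.1
    have himg : wordMap f (j :: l) '' B = f j '' D := Set.image_comp _ _ _
    refine ⟨himg ▸ hDm, ?_⟩
    rw [himg, selfSimilar_apply (fun i => (hf i).continuous.measurable) hinv hDm,
      Finset.sum_eq_single j, Set.preimage_image_eq _ (hf j).injective, ih.2, List.map_cons,
      List.prod_cons, mul_assoc]
    · intro i _ hij
      have hdisj : Disjoint (f i ⁻¹' (f j '' O)) (closure O) := by
        refine Disjoint.closure_right ?_ (((hf j).isOpenMap O hO).preimage (hf i).continuous)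
        refine Set.disjoint_left.2 fun y hy hyO => ?_
        exact Set.disjoint_left.1 (hOdisj i j hij) (Set.mem_image_of_mem _ hyO) hy
      have : μ (f i ⁻¹' (f j '' D)) = 0 := measure_mono_null (fun y hy hyE =>
        Set.disjoint_left.1 hdisj (Set.image_mono hsub hy) (hEO hyE)) hE
      rw [this, mul_zero]
    · simp

end SelfSimilar

section Metric

variable {X : Type*} [MetricSpace X] [MeasurableSpace X] [BorelSpace X] {m : ℕ}
  [Nonempty (Fin m)] {f : Fin m → X → X} {p r : Fin m → ℝ} {μ : Measure X} {E : Set X}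

theorem measure_ball_ne_zero [IsProbabilityMeasure μ] (hr : ∀ i, r i ∈ Set.Ioo (0 : ℝ) 1)
    (hf : ∀ i, IsSimilarityRatio (f i) (r i)) (hE : E = ⋃ i, f i '' E)
    (hEb : Bornology.IsBounded E) (hp : ∀ i, 0 < p i) (hpsum : ∑ i, p i = 1)
    (hsupp : μ Eᶜ = 0) (hinv : μ = ∑ i, ENNReal.ofReal (p i) • μ.map (f i))
    {z : X} (hz : z ∈ E) {δ : ℝ} (hδ : 0 < δ) : μ (Metric.ball z δ) ≠ 0 := by
  intro h0
  obtain ⟨l, hl⟩ := exists_wordMap_dist_lt hr hf hE hEb hEb hz hδ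
  have himg : wordMap f l '' E ⊆ Metric.ball z δ := Set.image_subset_iff.2 hl
  have := measure_eq_zero_of_measure_inter_image
    (fun i => ((hf i).continuous (hr i).1).measurable) hp hpsum hinv hsupp MeasurableSet.univ
    (fun i => Set.subset_univ _) l
    (measure_mono_null (Set.inter_subset_left.trans himg) h0)
  simp at this

/-- Almost every point of the attractor has dense shift orbit. -/
theorem measure_diff_denseOrbitSet [SecondCountableTopology X] [IsFiniteMeasure μ]
    (hr : ∀ i, r i ∈ Set.Ioo (0 : ℝ) 1)
    (hf : ∀ i, IsSimilarityRatio (f i) (r i)) (hsurj : ∀ i, Function.Surjective (f i))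
    (hE : E = ⋃ i, f i '' E)
    (hEc : IsCompact E) (hp : ∀ i, 0 < p i) (hpsum : ∑ i, p i = 1)
    (hsupp : μ Eᶜ = 0) (hinv : μ = ∑ i, ENNReal.ofReal (p i) • μ.map (f i)) :
    μ (E \ denseOrbitSet f E) = 0 := by
  have hmeas : ∀ i, Measurable (f i) := fun i => ((hf i).continuous (hr i).1).measurable
  have hEmap : ∀ i, Set.MapsTo (f i) E E := fun i y hy => by
    rw [hE]; exact Set.mem_iUnion.2 ⟨i, Set.mem_image_of_mem _ hy⟩
  have hwm : ∀ l, MeasurableEmbedding (wordMap f l) := fun l =>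
    ((isSimilarityRatio_wordMap hf l).isHomeomorph (prod_map_pos (fun i => (hr i).1) l)
      (wordMap_surjective hsurj l)).homeomorph.measurableEmbedding
  obtain ⟨b, hbc, -, hb⟩ := TopologicalSpace.exists_countable_basis X
  have key : ∀ U ∈ b, (U ∩ E).Nonempty →
      μ (⋃ l ∈ {l : List (Fin m) | l ≠ []}, wordMap f l '' (U ∩ E))ᶜ = 0 := by
    rintro U hU ⟨e, heU, heE⟩
    obtain ⟨ε, hε, hεU⟩ := Metric.isOpen_iff.1 (hb.isOpen hU) e heU
    obtain ⟨l, hl⟩ := exists_wordMap_dist_lt hr hf hE hEc.isBounded hEc.isBounded heE hε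
    obtain ⟨i₀⟩ := ‹Nonempty (Fin m)›
    refine measure_eq_zero_of_measure_inter_image hmeas hp hpsum hinv hsupp
      (MeasurableSet.compl (MeasurableSet.biUnion (Set.to_countable _) fun l _ =>
        (hwm l).measurableSet_image.2 ((hb.isOpen hU).measurableSet.inter hEc.measurableSet)))
      (fun i => ?_) (i₀ :: l) ?_
    · intro y hy hy'
      obtain ⟨l', hl', w, hw, rfl⟩ := Set.mem_iUnion₂.1 hy'
      exact hy (Set.mem_iUnion₂.2 ⟨i :: l', List.cons_ne_nil _ _, w, hw, rfl⟩)
    · convert measure_empty (μ := μ)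
      refine Set.eq_empty_of_forall_notMem ?_
      rintro _ ⟨⟨y, hy, rfl⟩, hn⟩
      exact hn (Set.mem_iUnion₂.2 ⟨[i₀], List.cons_ne_nil _ _, wordMap f l y,
        ⟨hεU (hl y hy), mapsTo_wordMap hEmap l hy⟩, rfl⟩)
  refine measure_mono_null ?_ ((measure_biUnion_null_iff
    (hbc.mono (Set.sep_subset b fun U => (U ∩ E).Nonempty))).2 fun U hU => key U hU.1 hU.2)
  rintro y ⟨hyE, hy⟩
  by_contra hcon
  refine hy ⟨hyE, fun e he => hb.mem_closure_iff.2 fun U hU heU => ?_⟩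
  by_contra hne
  refine hcon (Set.mem_iUnion₂.2 ⟨U, ⟨hU, e, heU, he⟩, fun hy' => hne ?_⟩)
  obtain ⟨l, hl, w, hw, rfl⟩ := Set.mem_iUnion₂.1 hy'
  exact ⟨w, hw.1, hw.2, l, hl, rfl⟩

/-- A point with dense shift orbit is reached from near any `z ∈ E` by words of small ratio. -/
theorem exists_wordMap_eq_of_mem_denseOrbitSet [IsProbabilityMeasure μ] [NullSingletonClass μ]
    (hr : ∀ i, r i ∈ Set.Ioo (0 : ℝ) 1)
    (hf : ∀ i, IsSimilarityRatio (f i) (r i)) (hE : E = ⋃ i, f i '' E)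
    (hEb : Bornology.IsBounded E) (hp : ∀ i, 0 < p i) (hpsum : ∑ i, p i = 1)
    (hsupp : μ Eᶜ = 0) (hinv : μ = ∑ i, ENNReal.ofReal (p i) • μ.map (f i))
    {x z : X} (hx : x ∈ denseOrbitSet f E) (hz : z ∈ E) {δ : ℝ} (hδ : 0 < δ) :
    ∃ w l, dist w z < δ ∧ wordMap f l w = x ∧ (l.map r).prod < δ := by
  obtain ⟨K, hK⟩ := exists_forall_length_prod_map_lt hr hδ
  set T : Set X := ⋃ l ∈ {l : List (Fin m) | l.length < K}, wordMap f l ⁻¹' {x} with hT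
  have hTfin : T.Finite := (List.finite_length_lt (Fin m) K).biUnion fun l _ =>
    (Set.finite_singleton x).preimage ((isSimilarityRatio_wordMap hf l).injective
      (prod_map_pos (fun i => (hr i).1) l)).injOn
  have hne : ((Metric.ball z δ \ T) ∩ E).Nonempty := by
    by_contra hcon
    rw [Set.not_nonempty_iff_eq_empty] at hcon
    refine measure_ball_ne_zero hr hf hE hEb hp hpsum hsupp hinv hz hδ
      (measure_mono_null (fun y hy => ?_) (measure_union_null (hTfin.measure_zero μ) hsupp))
    by_contra hy'
    rw [Set.mem_union, not_or, Set.notMem_compl_iff] at hy'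
    exact Set.notMem_empty y (hcon ▸ ⟨⟨hy, hy'.1⟩, hy'.2⟩)
  obtain ⟨e, heU, heE⟩ := hne
  obtain ⟨w, ⟨hwz, hwT⟩, -, l, -, hlw⟩ := mem_closure_iff.1 (hx.2 heE) _
    (Metric.isOpen_ball.sdiff hTfin.isClosed) heU
  refine ⟨w, l, hwz, hlw, hK l (not_lt.1 fun hl => hwT ?_)⟩
  exact Set.mem_iUnion₂.2 ⟨l, hl, hlw⟩

theorem tendsto_measure_closedBall_inter [IsFiniteMeasure μ] {w : ℕ → X} {z : X} {ρ : ℝ}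
    (hw : Tendsto w atTop (𝓝 z)) (hsph : μ (Metric.sphere z ρ) = 0) {A : Set X}
    (hA : MeasurableSet A) :
    Tendsto (fun j => μ (A ∩ Metric.closedBall (w j) ρ)) atTop
      (𝓝 (μ (A ∩ Metric.closedBall z ρ))) := by
  refine tendsto_measure_of_ae_tendsto_indicator_of_isFiniteMeasure atTop
    (hA.inter Metric.isClosed_closedBall.measurableSet)
    (fun j => hA.inter Metric.isClosed_closedBall.measurableSet) ?_
  filter_upwards [measure_eq_zero_iff_ae_notMem.1 hsph] with y hy
  have hd : Tendsto (fun j => dist y (w j)) atTop (𝓝 (dist y z)) := tendsto_const_nhds.dist hw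
  rcases lt_or_gt_of_ne (Metric.mem_sphere.not.1 hy) with h | h
  · filter_upwards [hd.eventually_lt_const h] with j hj
    simp [hj.le, h.le]
  · filter_upwards [hd.eventually_const_lt h] with j hj
    simp [hj.not_ge, h.not_ge]

end Metric

/-- under the SOSC, `μ_p(E ∖ Ê) = 0`, and for every `x ∈ Ê` and every
typical ball `B(z, ρ)`, there are surjective similarities `g_j` of ratios `t_j → ∞` and
constants `c_j > 0` with `c_j (g_j)_♯(μ_p⌊_{B(x, ρ t_j⁻¹)})` converging setwise to
`μ_p⌊_{B(z, ρ)}`: every typical restriction is a strong tangent measure at every `x ∈ Ê`. -/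
theorem stmt7 {n m : ℕ} (hn : 1 ≤ n) (hm : 2 ≤ m)
    (f : Fin m → EuclideanSpace ℝ (Fin n) → EuclideanSpace ℝ (Fin n))
    (r : Fin m → ℝ) (hr : ∀ i, r i ∈ Set.Ioo (0 : ℝ) 1)
    (hsim : ∀ i, IsSimilarityRatio (f i) (r i))
    (E : Set (EuclideanSpace ℝ (Fin n))) (hEcomp : IsCompact E) (hEne : E.Nonempty)
    (hEattr : E = ⋃ i, f i '' E)
    (O : Set (EuclideanSpace ℝ (Fin n))) (hOopen : IsOpen O) (hOne : O.Nonempty)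
    (hOmap : ∀ i, f i '' O ⊆ O)
    (hOdisj : ∀ i j, i ≠ j → Disjoint (f i '' O) (f j '' O))
    (hOE : (O ∩ E).Nonempty)
    (p : Fin m → ℝ) (hp : ∀ i, 0 < p i) (hpsum : ∑ i, p i = 1)
    (μ : Measure (EuclideanSpace ℝ (Fin n))) (hprob : IsProbabilityMeasure μ)
    (hsupp : μ Eᶜ = 0)
    (hinv : μ = ∑ i, ENNReal.ofReal (p i) • μ.map (f i))
    (hfront : μ (frontier O) = 0)
    (hsph : ∀ (z : EuclideanSpace ℝ (Fin n)) (ρ : ℝ), μ (Metric.sphere z ρ) = 0) :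
    μ (E \ denseOrbitSet f E) = 0 ∧
    ∀ x ∈ denseOrbitSet f E, ∀ z ∈ E, ∀ ρ : ℝ, 0 < ρ → Metric.closedBall z ρ ⊆ O →
      ∃ (g : ℕ → EuclideanSpace ℝ (Fin n) → EuclideanSpace ℝ (Fin n)) (t c : ℕ → ℝ),
        (∀ j, Function.Surjective (g j)) ∧
        (∀ j, IsSimilarityRatio (g j) (t j)) ∧
        Tendsto t atTop atTop ∧
        (∀ j, 0 < c j) ∧
        ∀ A : Set (EuclideanSpace ℝ (Fin n)), MeasurableSet A →
          Tendsto
            (fun j => ENNReal.ofReal (c j) *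
              (Measure.map (g j) (μ.restrict (Metric.closedBall x (ρ * (t j)⁻¹)))) A)
            atTop (nhds ((μ.restrict (Metric.closedBall z ρ)) A)) := by
  have : Nonempty (Fin m) := ⟨⟨0, by omega⟩⟩
  have hr0 : ∀ i, 0 < r i := fun i => (hr i).1
  have hsurj : ∀ i, Function.Surjective (f i) := fun i => (hsim i).surjective (hr0 i)
  refine ⟨measure_diff_denseOrbitSet hr hsim hsurj hEattr hEcomp hp hpsum hsupp hinv, ?_⟩
  intro x hx z hz ρ hρ hball
  have : NullSingletonClass μ := ⟨fun z => by simpa using hsph z 0⟩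
  have hOmap' : ∀ i, Set.MapsTo (f i) O O := fun i => Set.mapsTo_iff_image_subset.2 (hOmap i)
  obtain ⟨δ, hδ, hδO⟩ :=
    (isCompact_closedBall z ρ).exists_cthickening_subset_open hOopen hball
  rw [cthickening_closedBall hδ.le hρ.le] at hδO
  choose w l hwz hlx hlr using fun j : ℕ => exists_wordMap_eq_of_mem_denseOrbitSet hr hsim hEattr
    hEcomp.isBounded hp hpsum hsupp hinv hx hz
    (lt_min hδ (Nat.one_div_pos_of_nat (α := ℝ) (n := j)))
  have hF : ∀ j, IsSimilarityRatio (wordMap f (l j)) ((l j).map r).prod :=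
    fun j => isSimilarityRatio_wordMap hsim (l j)
  have hR : ∀ j, 0 < ((l j).map r).prod := fun j => prod_map_pos hr0 (l j)
  have hP : ∀ j, 0 < ((l j).map p).prod := fun j => prod_map_pos hp (l j)
  have hFs : ∀ j, Function.Surjective (wordMap f (l j)) := fun j => wordMap_surjective hsurj (l j)
  have hright := fun j => Function.rightInverse_surjInv (hFs j)
  have hleft := fun j => Function.leftInverse_surjInv ⟨(hF j).injective (hR j), hFs j⟩
  have hg := fun j => (hF j).of_rightInverse (hR j) (hright j)
  refine ⟨fun j => Function.surjInv (hFs j), fun j => (((l j).map r).prod)⁻¹,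
    fun j => (((l j).map p).prod)⁻¹, fun j => (hleft j).surjective, hg, ?_,
    fun j => inv_pos.2 (hP j), fun A hA => ?_⟩
  · refine tendsto_inv_nhdsGT_zero.comp (tendsto_nhdsWithin_iff.2 ⟨?_, .of_forall hR⟩)
    exact squeeze_zero (fun j => (hR j).le) (fun j => (hlr j).le.trans (min_le_right _ _))
      tendsto_one_div_add_atTop_nhds_zero_nat
  have hw : Tendsto w atTop (𝓝 z) := tendsto_iff_dist_tendsto_zero.2 <|
    squeeze_zero (fun _ => dist_nonneg) (fun j => (hwz j).le.trans (min_le_right _ _))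
      tendsto_one_div_add_atTop_nhds_zero_nat
  rw [Measure.restrict_apply hA]
  convert tendsto_measure_closedBall_inter hw (hsph z ρ) hA using 2 with j
  have hsub : A ∩ Metric.closedBall (w j) ρ ⊆ O := Set.inter_subset_right.trans <|
    (Metric.closedBall_subset_closedBall' (by
      have := (hwz j).le.trans (min_le_left _ _); linarith)).trans hδO
  have hscale := (measure_wordMap_image (fun i => (hsim i).isHomeomorph (hr0 i) (hsurj i)) hinv
    hsupp hOopen (subset_closure_of_mapsTo hr hsim hEattr hEcomp.isBounded hOne hOmap') hOmap'
    hOdisj (l j) (hA.inter Metric.isClosed_closedBall.measurableSet) hsub).2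
  have hgm : Measurable (Function.surjInv (hFs j)) :=
    ((hg j).continuous (inv_pos.2 (hR j))).measurable
  have hprod : ((l j).map fun i => ENNReal.ofReal (p i)).prod
      = ENNReal.ofReal ((l j).map p).prod := by
    induction l j with
    | nil => simp
    | cons i l ih => rw [List.map_cons, List.prod_cons, ih, List.map_cons, List.prod_cons,
        ENNReal.ofReal_mul (hp i).le]
  rw [Measure.map_apply hgm hA, Measure.restrict_apply (hgm hA), inv_inv, ← hlx j,
    ← (hF j).image_closedBall (hR j) (hFs j),
    ← Set.image_eq_preimage_of_inverse (hleft j) (hright j),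
    ← Set.image_inter ((hF j).injective (hR j)), hscale, hprod, ← mul_assoc,
    ENNReal.ofReal_inv_of_pos (hP j), ENNReal.inv_mul_cancel
      (ENNReal.ofReal_pos.2 (hP j)).ne' ENNReal.ofReal_ne_top, one_mul]
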